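/- Let S and A be finite sets, r: S×A → [0,1], γ ∈ (0,1), π a policy, and p° a nominal kernel (p°_{s,a} a probability vector on S for each (s,a)). Let P = ⊗_{s,a}P_{s,a} be an (s,a)-rectangular uncertainty set with each P_{s,a} a nonempty set of probability vectors on S, and define the robust Bellman operator (T^πV)(s) = Σ_a π(a|s)[ r(s,a) + γ·inf_{p∈P_{s,a}} pᵀV ]. Let P^π(s,s') = Σ_a π(a|s)p°_{s,a}(s') and let ν be a positive probability vector with νᵀP^π = νᵀ; let D = diag(ν), Ψ ∈ ℝ^{S×d} with linearly independent columns, and Π = Ψ(ΨᵀDΨ)^{-1}ΨᵀD. Suppose there exists β ∈ (0,1) with γ·p(s') ≤ β·p°_{s,a}(s') for all s, a, s' and all p ∈ P_{s,a}. Then ‖ΠT^πV − ΠT^πV'‖_ν ≤ β‖V − V'‖_ν for all V, V' ∈ ℝ^S; i.e., the projected robust Bellman operator is a β-contraction with respect to ‖·‖_ν. -/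

import Mathlib

open Finset Matrix

/-- The squared `ν`-weighted norm of the weighted least-squares projection of `u` is at most that
of `u`. -/
theorem sum_weighted_sq_projection_le {S ι : Type*} [Fintype S] [DecidableEq S] [Fintype ι]
    [DecidableEq ι] (ν : S → ℝ) (hν : ∀ s, 0 ≤ ν s) (Ψ : Matrix S ι ℝ) (u : S → ℝ) :
    ∑ s, ν s * ((Ψ * (Ψᵀ * diagonal ν * Ψ)⁻¹ * Ψᵀ * diagonal ν) *ᵥ u) s ^ 2 ≤
      ∑ s, ν s * u s ^ 2 := by
  set G := Ψᵀ * diagonal ν * Ψ with hG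
  set Q := Ψ * G⁻¹ * Ψᵀ * diagonal ν with hQ
  have hGsymm : Gᵀ = G := by
    simp [hG, Matrix.transpose_mul, Matrix.mul_assoc]
  have hGinv : G⁻¹ * G * G⁻¹ = G⁻¹ := by
    by_cases h : IsUnit G.det
    · rw [Matrix.nonsing_inv_mul G h, Matrix.one_mul]
    · simp [Matrix.nonsing_inv_apply_not_isUnit G h]
  have hQD : Qᵀ * diagonal ν * Q = Qᵀ * diagonal ν := by
    have hQt : Qᵀ = diagonal ν * Ψ * G⁻¹ * Ψᵀ := by
      simp [hQ, Matrix.transpose_mul, Matrix.transpose_nonsing_inv, hGsymm, Matrix.mul_assoc]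
    calc Qᵀ * diagonal ν * Q
        = diagonal ν * Ψ * (G⁻¹ * G * G⁻¹) * Ψᵀ * diagonal ν := by
          rw [hQt, hQ, hG]; simp only [Matrix.mul_assoc]
      _ = Qᵀ * diagonal ν := by rw [hGinv, hQt]
  have hdot (x y : S → ℝ) : x ⬝ᵥ (diagonal ν *ᵥ y) = ∑ s, ν s * (x s * y s) := by
    simp only [dotProduct, Matrix.mulVec_diagonal]
    exact Finset.sum_congr rfl fun s _ => by ring
  have horth : ∑ s, ν s * ((Q *ᵥ u) s * (Q *ᵥ u) s) = ∑ s, ν s * ((Q *ᵥ u) s * u s) := by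
    rw [← hdot, ← hdot]
    have h (y : S → ℝ) : (Q *ᵥ u) ⬝ᵥ y = u ⬝ᵥ (Qᵀ *ᵥ y) := by
      rw [Matrix.dotProduct_mulVec, Matrix.vecMul_transpose]
    rw [h, h, Matrix.mulVec_mulVec, Matrix.mulVec_mulVec, Matrix.mulVec_mulVec, hQD]
  have hnonneg : 0 ≤ ∑ s, ν s * (u s - (Q *ᵥ u) s) ^ 2 :=
    Finset.sum_nonneg fun s _ => mul_nonneg (hν s) (sq_nonneg _)
  have hexp : ∑ s, ν s * (u s - (Q *ᵥ u) s) ^ 2 = ∑ s, ν s * u s ^ 2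
      - 2 * ∑ s, ν s * ((Q *ᵥ u) s * u s) + ∑ s, ν s * ((Q *ᵥ u) s * (Q *ᵥ u) s) := by
    rw [Finset.mul_sum, ← Finset.sum_sub_distrib, ← Finset.sum_add_distrib]
    exact Finset.sum_congr rfl fun s _ => by ring
  have hsq : ∑ s, ν s * (Q *ᵥ u) s ^ 2 = ∑ s, ν s * ((Q *ᵥ u) s * (Q *ᵥ u) s) :=
    Finset.sum_congr rfl fun s _ => by ring
  linarith

/-- Worst-case expectations of `V` and `V'` differ by at most a multiple of the expectation of
`|V - V'|` under a dominating vector `q`. -/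
theorem mul_sInf_expectation_sub_le {S : Type*} [Fintype S] {P : Set (S → ℝ)} (hP : P.Nonempty)
    (hprob : ∀ p ∈ P, (∀ s, 0 ≤ p s) ∧ ∑ s, p s = 1) {γ β : ℝ} (hγ : 0 < γ) {q : S → ℝ}
    (hq : ∀ s, ∀ p ∈ P, γ * p s ≤ β * q s) (V V' : S → ℝ) :
    γ * sInf {x : ℝ | ∃ p ∈ P, x = ∑ s, p s * V s} -
        γ * sInf {x : ℝ | ∃ p ∈ P, x = ∑ s, p s * V' s} ≤
      β * ∑ s, q s * |V s - V' s| := by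
  have hbdd : BddBelow {x : ℝ | ∃ p ∈ P, x = ∑ s, p s * V s} := by
    refine ⟨-∑ s, |V s|, ?_⟩
    rintro x ⟨p, hp, rfl⟩
    obtain ⟨h0, h1⟩ := hprob p hp
    rw [← Finset.sum_neg_distrib]
    refine Finset.sum_le_sum fun s _ => ?_
    have hle : p s ≤ 1 := h1 ▸ Finset.single_le_sum (fun i _ => h0 i) (Finset.mem_univ s)
    nlinarith [neg_abs_le (V s), abs_nonneg (V s), h0 s]
  have key : sInf {x : ℝ | ∃ p ∈ P, x = ∑ s, p s * V s} - (β * ∑ s, q s * |V s - V' s|) / γ ≤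
      sInf {x : ℝ | ∃ p ∈ P, x = ∑ s, p s * V' s} := by
    obtain ⟨p₀, hp₀⟩ := hP
    refine le_csInf ⟨_, p₀, hp₀, rfl⟩ ?_
    rintro x ⟨p, hp, rfl⟩
    have hinf := csInf_le hbdd ⟨p, hp, rfl⟩
    have hdiff : γ * (∑ s, p s * V s - ∑ s, p s * V' s) ≤ β * ∑ s, q s * |V s - V' s| := by
      rw [← Finset.sum_sub_distrib, Finset.mul_sum, Finset.mul_sum]
      refine Finset.sum_le_sum fun s _ => ?_
      calc γ * (p s * V s - p s * V' s) = γ * p s * (V s - V' s) := by ring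
        _ ≤ γ * p s * |V s - V' s| :=
          mul_le_mul_of_nonneg_left (le_abs_self _) (mul_nonneg hγ.le ((hprob p hp).1 s))
        _ ≤ β * q s * |V s - V' s| := mul_le_mul_of_nonneg_right (hq s p hp) (abs_nonneg _)
        _ = β * (q s * |V s - V' s|) := by ring
    have hdiv := (le_div_iff₀' hγ).2 hdiff
    linarith
  have := mul_le_mul_of_nonneg_left key hγ.le
  rw [mul_sub, mul_div_cancel₀ _ hγ.ne'] at this
  linarith

/-- A stochastic matrix is nonexpansive in the squared norm weighted by an invariant vector. -/
theorem sum_weighted_sq_stochastic_le {S : Type*} [Fintype S] {ν : S → ℝ} (hν : ∀ s, 0 ≤ ν s)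
    {K : S → S → ℝ} (hK0 : ∀ s s', 0 ≤ K s s') (hK1 : ∀ s, ∑ s', K s s' = 1)
    (hstat : ∀ s', ∑ s, ν s * K s s' = ν s') {f : S → ℝ} (hf : ∀ s, 0 ≤ f s) :
    ∑ s, ν s * (∑ s', K s s' * f s') ^ 2 ≤ ∑ s, ν s * f s ^ 2 :=
  calc ∑ s, ν s * (∑ s', K s s' * f s') ^ 2
      ≤ ∑ s, ν s * ∑ s', K s s' * f s' ^ 2 :=
        Finset.sum_le_sum fun s _ => mul_le_mul_of_nonneg_left
          (Real.pow_arith_mean_le_arith_mean_pow _ _ _ (fun s' _ => hK0 s s') (hK1 s)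
            (fun s' _ => hf s') 2) (hν s)
    _ = ∑ s', (∑ s, ν s * K s s') * f s' ^ 2 := by
        simp only [Finset.mul_sum, Finset.sum_mul, ← mul_assoc]
        exact Finset.sum_comm
    _ = ∑ s, ν s * f s ^ 2 := by simp only [hstat]

/-- Proposition (Tamar et al., Prop. 3): under the coverage assumption
`γ p(s') ≤ β p°_{s,a}(s')` for all models `p` in the rectangular uncertainty
set, the projected robust Bellman operator is a `β`-contraction w.r.t. the
`ν`-weighted norm. -/
theorem stmt4 {S A : Type*} [Fintype S] [Fintype A] [DecidableEq S] {d : ℕ}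
    (r : S → A → ℝ) (hr : ∀ s a, r s a ∈ Set.Icc (0 : ℝ) 1)
    (γ : ℝ) (hγ0 : 0 < γ) (hγ1 : γ < 1)
    (π : S → A → ℝ) (hπ : ∀ s, (∀ a, 0 ≤ π s a) ∧ ∑ a, π s a = 1)
    (pnom : S → A → S → ℝ)
    (hpnom : ∀ s a, (∀ s', 0 ≤ pnom s a s') ∧ ∑ s', pnom s a s' = 1)
    (Pset : S → A → Set (S → ℝ)) (hPne : ∀ s a, (Pset s a).Nonempty)
    (hPprob : ∀ s a, ∀ p ∈ Pset s a, (∀ s', 0 ≤ p s') ∧ ∑ s', p s' = 1)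
    (ν : S → ℝ) (hν : ∀ s, 0 < ν s) (hν1 : ∑ s, ν s = 1)
    (hstat : ∀ s', ∑ s, ν s * (∑ a, π s a * pnom s a s') = ν s')
    (Ψ : Matrix S (Fin d) ℝ)
    (hΨ : LinearIndependent ℝ (fun j : Fin d => fun s : S => Ψ s j))
    (β : ℝ) (hβ0 : 0 < β) (hβ1 : β < 1)
    (hcover : ∀ s a s', ∀ p ∈ Pset s a, γ * p s' ≤ β * pnom s a s') :
    let T : (S → ℝ) → S → ℝ := fun V s =>
      ∑ a, π s a * (r s a + γ * sInf {x : ℝ | ∃ p ∈ Pset s a, x = ∑ s', p s' * V s'})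
    let D : Matrix S S ℝ := Matrix.diagonal ν
    let Proj : Matrix S S ℝ := Ψ * (Ψᵀ * D * Ψ)⁻¹ * Ψᵀ * D
    ∀ V V' : S → ℝ,
      Real.sqrt (∑ s, ν s * ((Proj *ᵥ T V) s - (Proj *ᵥ T V') s) ^ 2) ≤
        β * Real.sqrt (∑ s, ν s * (V s - V' s) ^ 2) := by
  intro T D Proj V V'
  have hT (V V' : S → ℝ) (s : S) :
      T V s - T V' s ≤ β * ∑ s', (∑ a, π s a * pnom s a s') * |V s' - V' s'| :=
    calc T V s - T V' s
        = ∑ a, π s a * (γ * sInf {x : ℝ | ∃ p ∈ Pset s a, x = ∑ s', p s' * V s'} -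
            γ * sInf {x : ℝ | ∃ p ∈ Pset s a, x = ∑ s', p s' * V' s'}) := by
          simp only [T, ← Finset.sum_sub_distrib]
          exact Finset.sum_congr rfl fun a _ => by ring
      _ ≤ ∑ a, π s a * (β * ∑ s', pnom s a s' * |V s' - V' s'|) :=
          Finset.sum_le_sum fun a _ => mul_le_mul_of_nonneg_left
            (mul_sInf_expectation_sub_le (hPne s a) (hPprob s a) hγ0 (hcover s a) V V')
            ((hπ s).1 a)
      _ = β * ∑ s', (∑ a, π s a * pnom s a s') * |V s' - V' s'| := by
          simp only [Finset.mul_sum, Finset.sum_mul]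
          rw [Finset.sum_comm]
          exact Finset.sum_congr rfl fun _ _ => Finset.sum_congr rfl fun _ _ => by ring
  have hTabs (s : S) :
      |T V s - T V' s| ≤ β * ∑ s', (∑ a, π s a * pnom s a s') * |V s' - V' s'| := by
    refine abs_sub_le_iff.2 ⟨hT V V' s, ?_⟩
    simpa only [abs_sub_comm] using hT V' V s
  have hK1 (s : S) : ∑ s', ∑ a, π s a * pnom s a s' = 1 := by
    rw [Finset.sum_comm]
    simp only [← Finset.mul_sum, (hpnom s _).2, mul_one, (hπ s).2]
  have hsq : ∑ s, ν s * ((Proj *ᵥ T V) s - (Proj *ᵥ T V') s) ^ 2 ≤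
      β ^ 2 * ∑ s, ν s * (V s - V' s) ^ 2 :=
    calc ∑ s, ν s * ((Proj *ᵥ T V) s - (Proj *ᵥ T V') s) ^ 2
        = ∑ s, ν s * (Proj *ᵥ (T V - T V')) s ^ 2 := by
          simp only [Matrix.mulVec_sub, Pi.sub_apply]
      _ ≤ ∑ s, ν s * (T V - T V') s ^ 2 :=
          sum_weighted_sq_projection_le ν (fun s => (hν s).le) Ψ _
      _ ≤ ∑ s, ν s * (β * ∑ s', (∑ a, π s a * pnom s a s') * |V s' - V' s'|) ^ 2 :=
          Finset.sum_le_sum fun s _ => mul_le_mul_of_nonneg_left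
            (sq_le_sq' (abs_le.1 (hTabs s)).1 (abs_le.1 (hTabs s)).2) (hν s).le
      _ = β ^ 2 * ∑ s, ν s * (∑ s', (∑ a, π s a * pnom s a s') * |V s' - V' s'|) ^ 2 := by
          rw [Finset.mul_sum]
          exact Finset.sum_congr rfl fun s _ => by ring
      _ ≤ β ^ 2 * ∑ s, ν s * |V s - V' s| ^ 2 :=
          mul_le_mul_of_nonneg_left
            (sum_weighted_sq_stochastic_le (fun s => (hν s).le)
              (fun s s' => Finset.sum_nonneg fun a _ =>
                mul_nonneg ((hπ s).1 a) ((hpnom s a).1 s'))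
              hK1 hstat (fun s => abs_nonneg _)) (sq_nonneg β)
      _ = β ^ 2 * ∑ s, ν s * (V s - V' s) ^ 2 := by simp only [sq_abs]
  calc _ ≤ Real.sqrt (β ^ 2 * ∑ s, ν s * (V s - V' s) ^ 2) := Real.sqrt_le_sqrt hsq
    _ = β * Real.sqrt (∑ s, ν s * (V s - V' s) ^ 2) := by
        rw [Real.sqrt_mul (sq_nonneg β), Real.sqrt_sq hβ0.le]
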